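/- arXiv:1608.06375 — 4 statements merged into one kernel-verified Lean document; each statement's English description precedes it below -/
import Mathlib

section
/- Let T be a symmetric linear operator defined on a dense subspace D of a complex Hilbert space 𝓗, and assume T maps D into itself (so T² is defined on D). If the set {T(T x) + x : x ∈ D} is dense in 𝓗, then both sets {T x + i • x : x ∈ D} and {T x − i • x : x ∈ D} are dense in 𝓗. (In particular, if T² is essentially selfadjoint then T is essentially selfadjoint.) -/
open InnerProductSpace

/-- Let `T` be a symmetric linear operator defined on a dense subspace `D` of a
complex Hilbert space `𝓗`, mapping `D` into itself.  If `{T (T x) + x : x ∈ D}` is dense in `𝓗`,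
then both `{T x + i • x : x ∈ D}` and `{T x - i • x : x ∈ D}` are dense in `𝓗`. -/
theorem statement0 {𝓗 : Type*} [NormedAddCommGroup 𝓗] [InnerProductSpace ℂ 𝓗] [CompleteSpace 𝓗]
    (D : Submodule ℂ 𝓗) (hdense : Dense (D : Set 𝓗))
    (T : D →ₗ[ℂ] 𝓗)
    (hsymm : ∀ x y : D, (inner ℂ (T x) (y : 𝓗) : ℂ) = inner ℂ (x : 𝓗) (T y))
    (hTD : ∀ x : D, T x ∈ D)
    (h2 : Dense {y : 𝓗 | ∃ x : D, T ⟨T x, hTD x⟩ + (x : 𝓗) = y}) :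
    Dense {y : 𝓗 | ∃ x : D, T x + Complex.I • (x : 𝓗) = y} ∧
      Dense {y : 𝓗 | ∃ x : D, T x - Complex.I • (x : 𝓗) = y} := by
  have hI (y : 𝓗) : Complex.I • Complex.I • y = -y := by
    rw [smul_smul, Complex.I_mul_I, neg_one_smul]
  constructor
  · refine h2.mono ?_
    rintro _ ⟨x, rfl⟩
    refine ⟨⟨T x, hTD x⟩ - Complex.I • x, ?_⟩
    simp only [map_sub, map_smul, Submodule.coe_sub, Submodule.coe_smul, smul_sub, hI]
    abel
  · refine h2.mono ?_
    rintro _ ⟨x, rfl⟩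
    refine ⟨⟨T x, hTD x⟩ + Complex.I • x, ?_⟩
    simp only [map_add, map_smul, Submodule.coe_add, Submodule.coe_smul, smul_add, hI]
    abel
end

section
/- For every real t > 0, exp(−t·(B + A)) = exp(−r(t)·A) · exp(−s(t)·B) · exp(−r(t)·A), where A = !![0, √2; 0, 0] and B = !![0, 0; √2, 0] are 2×2 real matrices, exp denotes the matrix exponential, r(t) = (1/√2)·sinh(t/√2)/cosh(t/√2), and s(t) = (1/√2)·sinh(√2·t). -/
open Matrix

/-- The matrix `A = !![0, √2; 0, 0]`. -/
noncomputable def mehlerA : Matrix (Fin 2) (Fin 2) ℝ := !![0, Real.sqrt 2; 0, 0]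

/-- The matrix `B = !![0, 0; √2, 0]`. -/
noncomputable def mehlerB : Matrix (Fin 2) (Fin 2) ℝ := !![0, 0; Real.sqrt 2, 0]

/-- `r(t) = (1/√2)·sinh(t/√2)/cosh(t/√2)`. -/
noncomputable def mehlerR (t : ℝ) : ℝ :=
  (1 / Real.sqrt 2) * (Real.sinh (t / Real.sqrt 2) / Real.cosh (t / Real.sqrt 2))

/-- `s(t) = (1/√2)·sinh(√2·t)`. -/
noncomputable def mehlerS (t : ℝ) : ℝ := (1 / Real.sqrt 2) * Real.sinh (Real.sqrt 2 * t)

/-- The exponential of a square-zero matrix. -/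
theorem exp_eq_one_add_of_sq_eq_zero {n : Type*} [Fintype n] [DecidableEq n]
    {M : Matrix n n ℝ} (h : M ^ 2 = 0) : NormedSpace.exp M = 1 + M := by
  have hM : ∀ k ∉ Finset.range 2, ((k.factorial : ℝ)⁻¹) • M ^ k = 0 := by
    intro k hk
    rw [pow_eq_zero_of_le (not_lt.mp (mt Finset.mem_range.mpr hk)) h, smul_zero]
  rw [NormedSpace.exp_eq_tsum ℝ]
  exact (tsum_eq_sum hM).trans (by simp [Finset.sum_range_succ])

/-- The exponential of a real multiple of the `2 × 2` swap matrix. -/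
theorem exp_antidiagonal (u : ℝ) :
    NormedSpace.exp !![0, u; u, 0] =
      !![Real.cosh u, Real.sinh u; Real.sinh u, Real.cosh u] := by
  let U : (Matrix (Fin 2) (Fin 2) ℝ)ˣ :=
    { val := !![1, 1; 1, -1]
      inv := !![1 / 2, 1 / 2; 1 / 2, -1 / 2]
      val_inv := by ext i j; fin_cases i <;> fin_cases j <;> norm_num [Matrix.mul_apply]
      inv_val := by ext i j; fin_cases i <;> fin_cases j <;> norm_num [Matrix.mul_apply] }
  have hU : U.val = !![1, 1; 1, -1] := rfl
  have hU' : (U⁻¹).val = !![1 / 2, 1 / 2; 1 / 2, -1 / 2] := rfl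
  have hconj : !![0, u; u, 0] = U.val * diagonal ![u, -u] * (U⁻¹).val := by
    rw [hU, hU']
    ext i j
    fin_cases i <;> fin_cases j <;>
      simp [Matrix.mul_apply, Fin.sum_univ_two, Matrix.vecMul_diagonal] <;> ring
  rw [hconj, Matrix.exp_units_conj, Matrix.exp_diagonal, hU, hU']
  ext i j
  fin_cases i <;> fin_cases j <;>
    simp [Matrix.mul_apply, Fin.sum_univ_two, Matrix.vecMul_diagonal, Pi.coe_exp,
      ← Real.exp_eq_exp_ℝ, Real.cosh_eq, Real.sinh_eq] <;> ring

/-- **Mehler's formula, 2×2 matrix form.** For every `t > 0`,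
`exp(−t(B + A)) = exp(−r(t)A) · exp(−s(t)B) · exp(−r(t)A)`. -/
theorem statement2 (t : ℝ) (ht : 0 < t) :
    NormedSpace.exp ((-t) • (mehlerB + mehlerA)) =
      NormedSpace.exp ((-(mehlerR t)) • mehlerA) *
        NormedSpace.exp ((-(mehlerS t)) • mehlerB) *
          NormedSpace.exp ((-(mehlerR t)) • mehlerA) := by
  have h2 : Real.sqrt 2 * Real.sqrt 2 = 2 := Real.mul_self_sqrt (by norm_num)
  have hA : (-(mehlerR t)) • mehlerA =
      !![0, -(Real.sinh (t / Real.sqrt 2) / Real.cosh (t / Real.sqrt 2)); 0, 0] := by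
    ext i j
    fin_cases i <;> fin_cases j <;> simp [mehlerA, mehlerR]
    field_simp
  have hB : (-(mehlerS t)) • mehlerB = !![0, 0; -Real.sinh (Real.sqrt 2 * t), 0] := by
    ext i j
    fin_cases i <;> fin_cases j <;> simp [mehlerB, mehlerS]
    field_simp
  have hAB : (-t) • (mehlerB + mehlerA) =
      !![0, -(Real.sqrt 2 * t); -(Real.sqrt 2 * t), 0] := by
    ext i j
    fin_cases i <;> fin_cases j <;> simp [mehlerA, mehlerB, mul_comm]
  have hu : Real.sqrt 2 * t = 2 * (t / Real.sqrt 2) := by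
    field_simp
    linear_combination h2
  rw [hA, hB, hAB, hu, exp_antidiagonal,
    exp_eq_one_add_of_sq_eq_zero (by simp [sq, ← Matrix.ext_iff]),
    exp_eq_one_add_of_sq_eq_zero (by simp [sq, ← Matrix.ext_iff]),
    Real.cosh_neg, Real.sinh_neg, Real.cosh_two_mul, Real.sinh_two_mul]
  have hc := (Real.cosh_pos (t / Real.sqrt 2)).ne'
  have hcs := Real.cosh_sq (t / Real.sqrt 2)
  generalize Real.cosh (t / Real.sqrt 2) = c at *
  generalize Real.sinh (t / Real.sqrt 2) = s at *
  ext i j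
  fin_cases i <;> fin_cases j <;> simp [Matrix.one_fin_two, Matrix.mul_apply, Fin.sum_univ_two]
  · field_simp
    linear_combination hcs
  · field_simp
    linear_combination -2 * s * hcs
  · field_simp
    linear_combination hcs
end

section
/- Let G be a locally compact, second countable Hausdorff topological group with left Haar measure μ, and let X be a locally compact, second countable Hausdorff topological space equipped with a continuous G-action such that the map G × X → X × X, (g, x) ↦ (g•x, x), is proper. Then there exists a cut-off function on X: a bounded continuous function c : X → ℝ with c ≥ 0 such that (i) for every compact subset K ⊆ X there is a compact subset L ⊆ G with c(g⁻¹•x) = 0 whenever x ∈ K and g ∉ L, and (ii) ∫_G c(g⁻¹•x)² dμ(g) = 1 for every x ∈ X. -/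
open MeasureTheory

/-- Along orbits, locally uniformly in the base point, `w` has compact support. -/
def HasOrbitCompactSupport (G : Type*) {X : Type*} [Group G] [TopologicalSpace G]
    [TopologicalSpace X] [MulAction G X] (w : X → ℝ) : Prop :=
  ∀ K : Set X, IsCompact K →
    ∃ L : Set G, IsCompact L ∧ ∀ x ∈ K, ∀ g : G, g ∉ L → w (g⁻¹ • x) = 0

theorem HasOrbitCompactSupport.hasCompactSupport {G X : Type*} [Group G] [TopologicalSpace G]
    [T2Space G] [TopologicalSpace X] [MulAction G X] {w : X → ℝ}
    (hw : HasOrbitCompactSupport G w) (x : X) : HasCompactSupport fun g : G => w (g⁻¹ • x) := by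
  obtain ⟨L, hL, h⟩ := hw {x} isCompact_singleton
  exact .intro hL (h x rfl)

theorem integral_inv_smul_smul {G X : Type*} [Group G] [MeasurableSpace G] [MeasurableMul G]
    [MulAction G X] (μ : Measure G) [μ.IsMulLeftInvariant] (w : X → ℝ) (h : G) (x : X) :
    ∫ g : G, w (g⁻¹ • h⁻¹ • x) ∂μ = ∫ g : G, w (g⁻¹ • x) ∂μ := by
  rw [← integral_mul_left_eq_self (fun g : G => w (g⁻¹ • x)) h]
  simp [mul_smul]

section Topology

variable {G X : Type*} [Group G] [TopologicalSpace G] [IsTopologicalGroup G]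
  [TopologicalSpace X] [MulAction G X]

theorem isCompact_setOf_inv_smul_mem
    (hproper : IsProperMap (fun p : G × X => (p.1 • p.2, p.2)))
    {S K : Set X} (hS : IsCompact S) (hK : IsCompact K) :
    IsCompact {g : G | ∃ x ∈ K, g⁻¹ • x ∈ S} := by
  have h := ((hproper.isCompact_preimage (hS.prod hK)).image continuous_fst).inv
  convert h using 1
  ext g
  simp only [Set.mem_inv, Set.mem_image, Set.mem_preimage, Set.mem_prod, Prod.exists,
    exists_and_right, exists_eq_right, Set.mem_ofPred_eq]
  exact exists_congr fun x => and_comm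

/-- A proper action on a locally compact, second countable Hausdorff space admits a nonnegative
continuous function that is positive somewhere on each orbit and has compact support along
orbits. -/
theorem exists_continuous_hasOrbitCompactSupport
    [LocallyCompactSpace X] [SecondCountableTopology X] [T2Space X] [ContinuousSMul G X]
    (hproper : IsProperMap (fun p : G × X => (p.1 • p.2, p.2))) :
    ∃ w : X → ℝ, Continuous w ∧ (∀ x, 0 ≤ w x) ∧ (∀ x, ∃ g : G, 0 < w (g • x)) ∧
      HasOrbitCompactSupport G w := by
  have : ProperSMul G X := ⟨hproper⟩
  let Y := Quotient (MulAction.orbitRel G X)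
  let π : X → Y := Quotient.mk (MulAction.orbitRel G X)
  have hπ : IsOpenQuotientMap π := MulAction.isOpenQuotientMap_quotientMk
  have hsmul (g : G) (x : X) : π (g • x) = π x := Quotient.sound ⟨g, rfl⟩
  have : T2Space Y := t2Space_quotient_mulAction_of_properSMul
  have : LocallyCompactSpace Y := hπ.locallyCompactSpace
  have : SecondCountableTopology Y := ContinuousConstSMul.secondCountableTopology
  choose C hC hxC using fun x : X => exists_compact_mem_nhds x
  choose u hu1 _ hucomp hu01 using fun x =>
    exists_continuous_one_zero_of_isCompact (hC x) isClosed_empty (Set.disjoint_empty _)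
  obtain ⟨χ, hχ⟩ := PartitionOfUnity.exists_isSubordinate (s := (Set.univ : Set Y)) isClosed_univ
    (fun x : X => π '' interior (C x)) (fun x => hπ.isOpenMap _ isOpen_interior) (by
      rintro y -
      obtain ⟨x, rfl⟩ := hπ.surjective y
      exact Set.mem_iUnion.2 ⟨x, x, mem_interior_iff_mem_nhds.2 (hxC x), rfl⟩)
  have hfin : LocallyFinite fun i => Function.support fun z => χ i (π z) * u i z :=
    (χ.locallyFinite.preimage_continuous hπ.continuous).subset fun i z hz =>
      left_ne_zero_of_mul hz
  have hnonneg (i z) : 0 ≤ χ i (π z) * u i z := mul_nonneg (χ.nonneg _ _) (hu01 _ _).1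
  refine ⟨fun z => ∑ᶠ i, χ i (π z) * u i z,
    continuous_finsum
      (fun i => ((χ i).continuous.comp hπ.continuous).mul (u i).continuous) hfin,
    fun z => finsum_nonneg fun i => hnonneg i z, fun z => ?_, fun K hK => ?_⟩
  · obtain ⟨i, hi⟩ := χ.exists_pos (Set.mem_univ (π z))
    obtain ⟨z', hz', hzz'⟩ := hχ i (subset_tsupport _ hi.ne')
    obtain ⟨g, rfl⟩ := Quotient.exact hzz'
    refine ⟨g, finsum_pos (fun j => hnonneg j _) ⟨i, ?_⟩ (hfin.point_finite _)⟩
    rw [hsmul, hu1 i (interior_subset hz')]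
    simpa using hi
  · have hs := χ.locallyFinite.finite_nonempty_inter_compact (hK.image hπ.continuous)
    refine ⟨_, isCompact_setOf_inv_smul_mem hproper
      (hs.isCompact_biUnion fun i _ => hucomp i) hK, fun x hx g hg => ?_⟩
    refine finsum_eq_zero_of_forall_eq_zero fun i => ?_
    by_contra hne
    refine hg ⟨x, hx, Set.mem_biUnion (x := i) ?_ (subset_tsupport _ (right_ne_zero_of_mul hne))⟩
    exact ⟨π x, by simpa [hsmul] using left_ne_zero_of_mul hne, x, hx, rfl⟩

end Topology

section Integral

variable {G X : Type*} [Group G] [TopologicalSpace G] [IsTopologicalGroup G]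
  [MeasurableSpace G] [BorelSpace G]
  [TopologicalSpace X] [MulAction G X] [ContinuousSMul G X] {w : X → ℝ}

theorem HasOrbitCompactSupport.continuous_integral [LocallyCompactSpace X]
    (hw : HasOrbitCompactSupport G w) (hc : Continuous w)
    (μ : Measure G) [IsFiniteMeasureOnCompacts μ] :
    Continuous fun x => ∫ g : G, w (g⁻¹ • x) ∂μ := by
  refine continuous_iff_continuousAt.2 fun x => ?_
  obtain ⟨K, hK, hxK⟩ := exists_compact_mem_nhds x
  obtain ⟨L, hL, h⟩ := hw K hK
  refine ContinuousOn.continuousAt (s := K) ?_ hxK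
  exact continuousOn_integral_of_compact_support hL
    (f := fun x g => w (g⁻¹ • x)) (by fun_prop) (fun x g hx hg => h x hx g hg)

theorem HasOrbitCompactSupport.integral_pos [T2Space G]
    (hw : HasOrbitCompactSupport G w) (hc : Continuous w) (h0 : ∀ x, 0 ≤ w x) {x : X}
    (hx : ∃ g : G, 0 < w (g • x)) (μ : Measure G) [μ.IsHaarMeasure] :
    0 < ∫ g : G, w (g⁻¹ • x) ∂μ := by
  obtain ⟨g, hg⟩ := hx
  exact Continuous.integral_pos_of_hasCompactSupport_nonneg_nonzero (x := g⁻¹) (by fun_prop)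
    (hw.hasCompactSupport x) (fun g => h0 _) (by simpa using hg.ne')

/-- Smearing `w` over `G` by a compactly supported `φ` multiplies its orbit integrals by the
constant `∫ φ(g⁻¹) dμ(g)`. -/
theorem HasOrbitCompactSupport.integral_integral_mul [T2Space G]
    (hw : HasOrbitCompactSupport G w) (hc : Continuous w) (μ : Measure G) [μ.IsHaarMeasure]
    {φ : G → ℝ} (hφ : Continuous φ) (hφs : HasCompactSupport φ) (x : X) :
    ∫ g : G, ∫ h : G, φ h * w (h⁻¹ • g⁻¹ • x) ∂μ ∂μ =
      (∫ g : G, φ g⁻¹ ∂μ) * ∫ g : G, w (g⁻¹ • x) ∂μ := by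
  have h1 (g : G) : ∫ h : G, φ h * w (h⁻¹ • g⁻¹ • x) ∂μ =
      ∫ h : G, φ (g⁻¹ * h) * w (h⁻¹ • x) ∂μ := by
    rw [← integral_mul_left_eq_self (fun h : G => φ (g⁻¹ * h) * w (h⁻¹ • x)) g]
    simp [mul_smul]
  have h2 (h : G) : ∫ g : G, φ (g⁻¹ * h) * w (h⁻¹ • x) ∂μ =
      (∫ g : G, φ g⁻¹ ∂μ) * w (h⁻¹ • x) := by
    rw [integral_mul_const,
      ← integral_mul_left_eq_self (fun g : G => φ (g⁻¹ * h)) h]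
    simp
  simp_rw [h1]
  rw [integral_integral_swap_of_hasCompactSupport]
  · simp_rw [h2]
    exact integral_const_mul _ _
  · simp only [Function.uncurry_def]
    fun_prop
  · obtain ⟨L, hL, h⟩ := hw {x} isCompact_singleton
    refine .intro ((hL.mul hφs.isCompact.inv).prod hL) ?_
    rintro ⟨g, k⟩ hgk
    by_contra hne
    have hk : k ∈ L := by
      by_contra hk
      exact right_ne_zero_of_mul hne (h x rfl k hk)
    exact hgk ⟨⟨k, hk, k⁻¹ * g, by
      simpa using subset_tsupport _ (left_ne_zero_of_mul hne), by simp⟩, hk⟩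

end Integral

/-- If `G` is a locally compact, second countable Hausdorff group with left
Haar measure `μ` and `X` is a locally compact, second countable Hausdorff proper `G`-space, then
there is a cut-off function on `X`: a bounded nonnegative continuous `c : X → ℝ` such that for
every compact `K ⊆ X` there is a compact `L ⊆ G` with `c (g⁻¹ • x) = 0` for `x ∈ K`, `g ∉ L`,
and `∫_G c(g⁻¹ • x)² dμ(g) = 1` for every `x`. -/
theorem statement12 {G X : Type*}
    [Group G] [TopologicalSpace G] [IsTopologicalGroup G]
    [LocallyCompactSpace G] [SecondCountableTopology G] [T2Space G]
    [MeasurableSpace G] [BorelSpace G]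
    (μ : Measure G) [μ.IsHaarMeasure]
    [TopologicalSpace X] [LocallyCompactSpace X] [SecondCountableTopology X] [T2Space X]
    [MulAction G X] [ContinuousSMul G X]
    (hproper : IsProperMap (fun p : G × X => (p.1 • p.2, p.2))) :
    ∃ c : X → ℝ, Continuous c ∧ (∃ M : ℝ, ∀ x : X, c x ≤ M) ∧ (∀ x : X, 0 ≤ c x) ∧
      (∀ K : Set X, IsCompact K →
        ∃ L : Set G, IsCompact L ∧ ∀ x ∈ K, ∀ g : G, g ∉ L → c (g⁻¹ • x) = 0) ∧
      ∀ x : X, ∫ g : G, (c (g⁻¹ • x)) ^ 2 ∂μ = 1 := by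
  obtain ⟨w, hwc, hw0, hwpos, hws⟩ := exists_continuous_hasOrbitCompactSupport hproper
  obtain ⟨φ, hφ1, -, hφs, hφ01⟩ := exists_continuous_one_zero_of_isCompact
    (isCompact_singleton (x := (1 : G))) isClosed_empty (Set.disjoint_empty _)
  set F : X → ℝ := fun x => ∫ g : G, w (g⁻¹ • x) ∂μ with hF
  set N : X → ℝ := fun x => ∫ h : G, φ h * w (h⁻¹ • x) ∂μ with hN
  set A : ℝ := ∫ g : G, φ g⁻¹ ∂μ with hA
  have hFc : Continuous F := hws.continuous_integral hwc μ
  have hFpos (x : X) : 0 < F x := hws.integral_pos hwc hw0 (hwpos x) μ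
  have hFinv (g : G) (x : X) : F (g⁻¹ • x) = F x := integral_inv_smul_smul μ w g x
  have hNc : Continuous N := by
    refine continuousOn_univ.1 (continuousOn_integral_of_compact_support hφs.isCompact
      (f := fun x g => φ g * w (g⁻¹ • x)) (by fun_prop) fun x g _ hg => ?_)
    rw [image_eq_zero_of_notMem_tsupport hg, zero_mul]
  have hN0 (x : X) : 0 ≤ N x := integral_nonneg fun h => mul_nonneg (hφ01 h).1 (hw0 _)
  have hNF (x : X) : N x ≤ F x := by
    have hi : Continuous fun g : G => w (g⁻¹ • x) := by fun_prop
    exact integral_mono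
      ((φ.continuous.mul hi).integrable_of_hasCompactSupport hφs.mul_right)
      (hi.integrable_of_hasCompactSupport (hws.hasCompactSupport x))
      fun h => mul_le_of_le_one_left (hw0 _) (hφ01 h).2
  have hApos : 0 < A :=
    Continuous.integral_pos_of_hasCompactSupport_nonneg_nonzero (x := 1) (by fun_prop)
      (hφs.comp_homeomorph (Homeomorph.inv G)) (fun g => (hφ01 _).1) (by simp [hφ1 rfl])
  refine ⟨fun x => √(N x / (A * F x)), ?_, ⟨√(1 / A), fun x => ?_⟩, fun x => Real.sqrt_nonneg _,
    fun K hK => ?_, fun x => ?_⟩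
  · exact (hNc.div (continuous_const.mul hFc) fun x => (mul_pos hApos (hFpos x)).ne').sqrt
  · refine Real.sqrt_le_sqrt ?_
    rw [div_le_div_iff₀ (mul_pos hApos (hFpos x)) hApos]
    nlinarith [hNF x]
  · obtain ⟨L, hL, h⟩ := hws K hK
    refine ⟨_, hL.mul hφs.isCompact.inv, fun x hx g hg => ?_⟩
    have : N (g⁻¹ • x) = 0 := by
      refine integral_eq_zero_of_ae (.of_forall fun k => ?_)
      by_contra hne
      have hk : g * k ∈ L := by
        by_contra hk
        apply right_ne_zero_of_mul hne
        simpa [mul_smul] using h x hx _ hk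
      exact hg ⟨g * k, hk, k⁻¹, by
        simpa using subset_tsupport _ (left_ne_zero_of_mul hne), by simp⟩
    simp [this]
  · have hsq (g : G) : √(N (g⁻¹ • x) / (A * F (g⁻¹ • x))) ^ 2 = N (g⁻¹ • x) / (A * F x) := by
      rw [hFinv, Real.sq_sqrt (div_nonneg (hN0 _) (mul_pos hApos (hFpos x)).le)]
    simp_rw [hsq]
    rw [integral_div, hws.integral_integral_mul hwc μ φ.continuous hφs x]
    exact div_self (mul_pos hApos (hFpos x)).ne'
end

section
/- Let h : D → 𝓗 be a linear map defined on a dense subspace D of a real Hilbert space 𝓗, and let w ∈ 𝓗. Then the functional v ↦ ⟨w, h v⟩ is bounded on D (i.e. w lies in the domain of the adjoint h*) if and only if for every ε > 0 there exists a finite-dimensional subspace W' contained in D such that for every finite-dimensional subspace W'' with W' ⊆ W'' ⊆ D and every finite orthonormal family e₁, …, e_l of vectors of W'' each orthogonal to W', one has Σ_{k=1}^{l} ⟨w, h(e_k)⟩² < ε. -/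
/-- A bounded functional on a dense subspace is, on finite orthonormal families orthogonal to a
suitable vector of the subspace, square summable with arbitrarily small sum. -/
lemma exists_mem_sum_sq_lt_of_bounded {E : Type*} [NormedAddCommGroup E] [InnerProductSpace ℝ E]
    [CompleteSpace E] (D : Submodule ℝ E) (hD : Dense (D : Set E)) (f : D →ₗ[ℝ] ℝ) (C : ℝ)
    (hf : ∀ v : D, |f v| ≤ C * ‖(v : E)‖) {ε : ℝ} (hε : 0 < ε) :
    ∃ d ∈ D, ∀ (l : ℕ) (e : Fin l → D), Orthonormal ℝ (fun k => (e k : E)) →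
      (∀ k, inner ℝ (e k : E) d = 0) → ∑ k, f (e k) ^ 2 < ε := by
  obtain ⟨g, hg, -⟩ := exists_extension_norm_eq D (f.mkContinuous C hf)
  set z := (InnerProductSpace.toDual ℝ E).symm g
  have hz (v : D) : inner ℝ z (v : E) = f v := by
    rw [InnerProductSpace.toDual_symm_apply, hg]
    rfl
  obtain ⟨d, hdD, hd⟩ := Metric.dense_iff.1 hD z (√ε) (Real.sqrt_pos.2 hε)
  rw [Metric.mem_ball, dist_comm, dist_eq_norm] at hdD
  refine ⟨d, hd, fun l e he horth => ?_⟩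
  have hsum := he.sum_inner_products_le (z - d) (s := Finset.univ)
  have hk (k : Fin l) : ‖inner ℝ (e k : E) (z - d)‖ ^ 2 = f (e k) ^ 2 := by
    rw [inner_sub_right, horth k, sub_zero, real_inner_comm, hz, Real.norm_eq_abs, sq_abs]
  simp only [hk] at hsum
  exact hsum.trans_lt ((Real.lt_sqrt (norm_nonneg _)).1 hdD)

/-- A linear functional which is bounded on the vectors orthogonal to a finite-dimensional
subspace is bounded. -/
lemma exists_bound_of_bound_orthogonal {E : Type*} [NormedAddCommGroup E]
    [InnerProductSpace ℝ E] (f : E →ₗ[ℝ] ℝ) (W : Submodule ℝ E) [FiniteDimensional ℝ W]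
    (hf : ∀ v ∈ Wᗮ, |f v| ≤ ‖v‖) : ∃ C : ℝ, ∀ v : E, |f v| ≤ C * ‖v‖ := by
  let g : W →L[ℝ] ℝ := LinearMap.toContinuousLinearMap (f ∘ₗ W.subtype)
  refine ⟨‖g‖ + 1, fun v => ?_⟩
  have h₁ : |f (W.orthogonalProjectionOnto v)| ≤ ‖g‖ * ‖v‖ :=
    (g.le_opNorm (W.orthogonalProjectionOnto v)).trans
      (mul_le_mul_of_nonneg_left (W.norm_orthogonalProjectionOnto_apply_le v) (norm_nonneg g))
  have h₂ : |f (Wᗮ.orthogonalProjectionOnto v)| ≤ ‖v‖ :=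
    (hf _ (Submodule.coe_mem _)).trans (Wᗮ.norm_orthogonalProjectionOnto_apply_le v)
  have hv : f v = f (W.orthogonalProjectionOnto v) + f (Wᗮ.orthogonalProjectionOnto v) := by
    rw [← map_add]
    exact congrArg f (W.starProjection_add_starProjection_orthogonal v).symm
  calc |f v| ≤ |f (W.orthogonalProjectionOnto v)| + |f (Wᗮ.orthogonalProjectionOnto v)| :=
        hv ▸ abs_add_le _ _
    _ ≤ (‖g‖ + 1) * ‖v‖ := by linarith

/-- Let `h : D → 𝓗` be a densely defined linear operator on a real Hilbert
space and `w ∈ 𝓗`.  Then `v ↦ ⟨w, h v⟩` is bounded on `D` (i.e. `w` is in the domain of the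
adjoint) iff for every `ε > 0` there is a finite-dimensional subspace `W' ⊆ D` such that for
every finite-dimensional `W''` with `W' ⊆ W'' ⊆ D` and every finite orthonormal family
`e₁, …, e_l` of vectors of `W''` each orthogonal to `W'`, `Σ_k ⟨w, h(e_k)⟩² < ε`. -/
theorem statement13 {𝓗 : Type*} [NormedAddCommGroup 𝓗] [InnerProductSpace ℝ 𝓗]
    [CompleteSpace 𝓗]
    (D : Submodule ℝ 𝓗) (hdense : Dense (D : Set 𝓗)) (h : D →ₗ[ℝ] 𝓗) (w : 𝓗) :
    (∃ C : ℝ, ∀ v : D, |(inner ℝ w (h v) : ℝ)| ≤ C * ‖(v : 𝓗)‖) ↔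
      ∀ ε > (0 : ℝ), ∃ W' : Submodule ℝ 𝓗, FiniteDimensional ℝ W' ∧ (W' : Set 𝓗) ⊆ D ∧
        ∀ W'' : Submodule ℝ 𝓗, FiniteDimensional ℝ W'' → W' ≤ W'' →
          ∀ hsub : (W'' : Set 𝓗) ⊆ D,
            ∀ (l : ℕ) (e : Fin l → 𝓗) (he : ∀ k : Fin l, e k ∈ W''),
              Orthonormal ℝ e → (∀ (k : Fin l), ∀ u ∈ W', (inner ℝ (e k) u : ℝ) = 0) →
                (∑ k : Fin l, (inner ℝ w (h ⟨e k, hsub (he k)⟩) : ℝ) ^ 2) < ε := by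
  let f : D →ₗ[ℝ] ℝ := (innerₗ 𝓗 w) ∘ₗ h
  constructor
  · rintro ⟨C, hC⟩ ε hε
    obtain ⟨d, hd, hsum⟩ := exists_mem_sum_sq_lt_of_bounded D hdense f C hC hε
    refine ⟨ℝ ∙ d, inferInstance, ?_, fun W'' _ _ hsub l e he hon horth => ?_⟩
    · exact (Submodule.span_singleton_le_iff_mem d D).2 hd
    · exact hsum l (fun k => ⟨e k, hsub (he k)⟩) hon
        fun k => horth k d (Submodule.mem_span_singleton_self d)
  · intro H
    obtain ⟨W', hfin, hW'D, hW'⟩ := H 1 one_pos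
    let W : Submodule ℝ D := W'.comap D.subtype
    have : FiniteDimensional ℝ W :=
      (Submodule.comapSubtypeEquivOfLe (show W' ≤ D from hW'D)).symm.finiteDimensional
    refine exists_bound_of_bound_orthogonal f W fun v hv => ?_
    rcases eq_or_ne v 0 with rfl | hv0
    · simp
    have hnv : 0 < ‖v‖ := norm_pos_iff.2 hv0
    let e : D := ‖v‖⁻¹ • v
    have he1 : ‖e‖ = 1 := norm_smul_inv_norm hv0
    have hsub : ((W' ⊔ ℝ ∙ (e : 𝓗) : Submodule ℝ 𝓗) : Set 𝓗) ⊆ D :=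
      sup_le (show W' ≤ D from hW'D) ((Submodule.span_singleton_le_iff_mem _ D).2 e.2)
    have hlt := hW' (W' ⊔ ℝ ∙ (e : 𝓗)) inferInstance le_sup_left hsub 1 (fun _ => (e : 𝓗))
      (fun _ => Submodule.mem_sup_right (Submodule.mem_span_singleton_self _))
      ⟨fun _ => he1, fun i j hij => (hij (Subsingleton.elim i j)).elim⟩
      (fun _ u hu => Submodule.inner_left_of_mem_orthogonal (K := W)
        (u := ⟨u, hW'D hu⟩) hu (Wᗮ.smul_mem _ hv))
    have hfe : f e ^ 2 < 1 := by rwa [Fin.sum_univ_one] at hlt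
    have hfv : f e = ‖v‖⁻¹ * f v := by simp [e]
    rw [sq_lt_one_iff_abs_lt_one, hfv, abs_mul, abs_inv, abs_norm, inv_mul_lt_one₀ hnv] at hfe
    exact hfe.le
end
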